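/- A Boolean function f : B^n → B is locally monotone (i.e., 2-locally monotone) if and only if ∨_k∧_j f = ∧_j∨_k f holds for all j, k ∈ [n] with j ≠ k. -/

import Mathlib

open Finset

/-- Discrete partial derivative: `Δ_k f (x) = f(x_k^1) - f(x_k^0)`. -/
def pderiv {ι : Type*} [DecidableEq ι] (f : (ι → Bool) → ℝ) (k : ι) (x : ι → Bool) : ℝ :=
  f (Function.update x k true) - f (Function.update x k false)

/-- Meet derivative: `∧_k f (x) = f(x_k^0) ⊓ f(x_k^1)`. -/
def meetD {ι : Type*} [DecidableEq ι] (f : (ι → Bool) → ℝ) (k : ι) (x : ι → Bool) : ℝ :=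
  min (f (Function.update x k false)) (f (Function.update x k true))

/-- Join derivative: `∨_k f (x) = f(x_k^0) ⊔ f(x_k^1)`. -/
def joinD {ι : Type*} [DecidableEq ι] (f : (ι → Bool) → ℝ) (k : ι) (x : ι → Bool) : ℝ :=
  max (f (Function.update x k false)) (f (Function.update x k true))

/-- `f` is `p`-locally monotone: no partial derivative changes sign on tuples differing
in fewer than `p` positions (other than the `k`-th one). -/
def LocallyMonotone {n : ℕ} (p : ℕ) (f : (Fin n → Bool) → ℝ) : Prop :=
  ∀ k : Fin n, ∀ x y : Fin n → Bool,
    (Finset.univ.filter (fun i => i ≠ k ∧ x i ≠ y i)).card < p →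
    0 ≤ pderiv f k x * pderiv f k y

/-- A lattice-derivative operator: `(true, k)` is `∨_k`, `(false, k)` is `∧_k`. -/
def latD {ι : Type*} [DecidableEq ι] (ok : Bool × ι) (f : (ι → Bool) → ℝ) : (ι → Bool) → ℝ :=
  if ok.1 then joinD f ok.2 else meetD f ok.2

/-- Composition `O_{k_1} ⋯ O_{k_p} f` of the operators listed in `l`. -/
def applyOps {ι : Type*} [DecidableEq ι] (l : List (Bool × ι)) (f : (ι → Bool) → ℝ) :
    (ι → Bool) → ℝ := l.foldr latD f

/-- `f` has `p`-permutable lattice derivatives. -/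
def Permutable {ι : Type*} [DecidableEq ι] (p : ℕ) (f : (ι → Bool) → ℝ) : Prop :=
  ∀ l l' : List (Bool × ι), l.length = p → (l.map Prod.snd).Nodup → l.Perm l' →
    applyOps l f = applyOps l' f

/-- `f` is monotone: each partial derivative is everywhere nonnegative or everywhere
nonpositive. -/
def IsMonotoneFn {ι : Type*} [DecidableEq ι] (f : (ι → Bool) → ℝ) : Prop :=
  ∀ k : ι, (∀ x, 0 ≤ pderiv f k x) ∨ (∀ x, pderiv f k x ≤ 0)

/-- The tuple `a_S^x`: `i`-th component `x i` if `i ∈ S`, and `a i` otherwise. -/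
def restrictTo {n : ℕ} (S : Finset (Fin n)) (a : Fin n → Bool) (x : {i // i ∈ S} → Bool) :
    Fin n → Bool := fun i => if h : i ∈ S then x ⟨i, h⟩ else a i

/-- `g` is an `S`-section of `f`. -/
def IsSection {n : ℕ} (S : Finset (Fin n)) (f : (Fin n → Bool) → ℝ)
    (g : ({i // i ∈ S} → Bool) → ℝ) : Prop :=
  ∃ a : Fin n → Bool, ∀ x, g x = f (restrictTo S a x)

/-- A Boolean function viewed as real-valued. -/
def toReal {n : ℕ} (f : (Fin n → Bool) → Bool) : (Fin n → Bool) → ℝ :=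
  fun x => if f x then 1 else 0

/-- On a two-dimensional face of the cube, for `0/1` values, exchanging `∨` and `∧` is equivalent
to the two parallel differences not having opposite signs. -/
theorem max_min_eq_min_max_iff_mul_nonneg (a b c d : Bool) :
    max (min (if a then (1 : ℝ) else 0) (if c then 1 else 0))
        (min (if b then 1 else 0) (if d then 1 else 0)) =
      min (max (if a then 1 else 0) (if b then 1 else 0))
        (max (if c then 1 else 0) (if d then 1 else 0)) ↔
    0 ≤ ((if b then (1 : ℝ) else 0) - (if a then 1 else 0)) *
      ((if d then 1 else 0) - (if c then 1 else 0)) := by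
  cases a <;> cases b <;> cases c <;> cases d <;> norm_num

theorem joinD_meetD_eq_iff_pderiv_mul_nonneg {n : ℕ} (f : (Fin n → Bool) → Bool) {j k : Fin n}
    (hjk : j ≠ k) (x : Fin n → Bool) :
    joinD (meetD (toReal f) j) k x = meetD (joinD (toReal f) k) j x ↔
      0 ≤ pderiv (toReal f) k (Function.update x j false) *
        pderiv (toReal f) k (Function.update x j true) := by
  simp only [joinD, meetD, pderiv, toReal, Function.update_comm hjk.symm]
  exact max_min_eq_min_max_iff_mul_nonneg _ _ _ _

theorem pderiv_congr {ι : Type*} [DecidableEq ι] (f : (ι → Bool) → ℝ) {k : ι} {x y : ι → Bool}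
    (h : ∀ i, i ≠ k → x i = y i) : pderiv f k x = pderiv f k y := by
  have key : ∀ b, Function.update x k b = Function.update y k b := by
    intro b
    ext i
    by_cases hi : i = k
    · subst hi; simp
    · simp [hi, h i hi]
  simp only [pderiv, key]

theorem locallyMonotone_two_iff {n : ℕ} (f : (Fin n → Bool) → ℝ) :
    LocallyMonotone 2 f ↔ ∀ j k : Fin n, j ≠ k → ∀ x : Fin n → Bool,
      0 ≤ pderiv f k (Function.update x j false) * pderiv f k (Function.update x j true) := by
  constructor
  · intro h j k _ x
    refine h k _ _ (lt_of_le_of_lt (card_le_card (t := {j}) ?_) (by simp))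
    intro i hi
    by_contra hij
    simp_all
  · intro h k x y hxy
    by_cases hne : ∃ j, j ≠ k ∧ x j ≠ y j
    · obtain ⟨j, hjk, hj⟩ := hne
      have hagree : ∀ i, i ≠ k → i ≠ j → x i = y i := by
        intro i hik hij
        by_contra hi
        exact hij (card_le_one.mp (Nat.lt_succ_iff.mp hxy) i (by simp [hik, hi]) j
          (by simp [hjk, hj]))
      have hy : pderiv f k y = pderiv f k (Function.update x j (y j)) := by
        refine pderiv_congr f fun i hik => ?_
        by_cases hij : i = j
        · subst hij; simp
        · simp [hij, hagree i hik hij]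
      have hx : pderiv f k x = pderiv f k (Function.update x j (x j)) := by
        rw [Function.update_eq_self]
      have hface := h j k hjk x
      rw [hx, hy]
      cases hxj : x j <;> cases hyj : y j <;> simp_all [mul_comm]
    · push Not at hne
      rw [pderiv_congr f hne]
      exact mul_self_nonneg _

theorem stmt8 {n : ℕ} (f : (Fin n → Bool) → Bool) :
    LocallyMonotone 2 (toReal f) ↔
      ∀ j k : Fin n, j ≠ k →
        joinD (meetD (toReal f) j) k = meetD (joinD (toReal f) k) j := by
  rw [locallyMonotone_two_iff]
  refine forall₃_congr fun j k hjk => ?_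
  rw [funext_iff]
  exact forall_congr' fun x => (joinD_meetD_eq_iff_pderiv_mul_nonneg f hjk x).symm
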